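/- arXiv:0907.2430 — 3 statements merged into one kernel-verified Lean document; each statement's English description precedes it below -/
import Mathlib

section
/- Let s be a sequence over a finite alphabet taking exactly a ≥ 2 distinct values, and let p(k) denote the number of distinct factors of s of length k. Then the following six properties are equivalent: (i) there exists k₀ ≥ 1 such that p(k₀+1) = p(k₀); (ii) the sequence (p(k))_{k≥1} is ultimately constant, i.e., there exist C and K such that p(k) = C for all k ≥ K; (iii) there exists M such that p(k) ≤ M for all k ≥ 1; (iv) there exists k₁ ≥ 1 such that p(k₁) ≤ k₁ + a − 2; (v) setting g(k) = p(k) − k, there exists k₂ ≥ 1 such that g(k₂+1) < g(k₂); (vi) s is ultimately periodic. -/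
/-- The finite word `s(i) s(i+1) ⋯ s(i+k−1)`. -/
def window {A : Type*} (s : ℕ → A) (i k : ℕ) : List A :=
  (List.range k).map fun j => s (i + j)

/-- `l` is a factor of the sequence `s`. -/
def IsFactor {A : Type*} (s : ℕ → A) (l : List A) : Prop :=
  ∃ i, l = window s i l.length

/-- The number of distinct factors of `s` of length `k` (complexity function). -/
noncomputable def complexity {A : Type*} (s : ℕ → A) (k : ℕ) : ℕ :=
  Set.ncard {l : List A | l.length = k ∧ IsFactor s l}

/-- The shift map. -/
def shiftMap {A : Type*} (s : ℕ → A) : ℕ → A := fun n => s (n + 1)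

/-- The sequence `x·u`. -/
def pre {A : Type*} (x : A) (u : ℕ → A) : ℕ → A
  | 0 => x
  | n + 1 => u n

/-- Strict lexicographic order on sequences. -/
def SeqLt {A : Type*} [LT A] (u v : ℕ → A) : Prop :=
  ∃ i, (∀ j < i, u j = v j) ∧ u i < v i

/-- Lexicographic order on sequences. -/
def SeqLe {A : Type*} [LT A] (u v : ℕ → A) : Prop :=
  (∀ n, u n = v n) ∨ SeqLt u v

/-- Lexicographic order on (equal-length) finite words. -/
def WordLe {A : Type*} [LT A] (u v : List A) : Prop :=
  u = v ∨ List.Lex (· < ·) u v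

def UltimatelyPeriodic {A : Type*} (s : ℕ → A) : Prop :=
  ∃ N, ∃ q ≥ 1, ∀ n ≥ N, s (n + q) = s n

/-- A binary sequence is Sturmian if it has complexity `k + 1` for all `k ≥ 1`. -/
def Sturmian (s : ℕ → Fin 2) : Prop :=
  ∀ k ≥ 1, complexity s k = k + 1

/-- `w` is a left special factor of `s`. -/
def LeftSpecial {A : Type*} (s : ℕ → A) (w : List A) : Prop :=
  ∃ x y : A, x ≠ y ∧ IsFactor s (x :: w) ∧ IsFactor s (y :: w)

/-- A binary sequence is balanced. -/
def BalancedSeq (s : ℕ → Fin 2) : Prop :=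
  ∀ u v : List (Fin 2), IsFactor s u → IsFactor s v → u.length = v.length →
    ((u.count 1 : ℤ) - (v.count 1 : ℤ)).natAbs ≤ 1

/-- `u` is the characteristic Sturmian sequence of slope `α`. -/
def IsCharSturmian (α : ℝ) (u : ℕ → Fin 2) : Prop :=
  ∀ n : ℕ, ((u n : ℕ) : ℤ) = ⌊((n : ℝ) + 2) * α⌋ - ⌊((n : ℝ) + 1) * α⌋

theorem window_length' {A : Type*} (s : ℕ → A) (i k : ℕ) : (window s i k).length = k := by
  simp [window]

theorem window_eq_iff {A : Type*} (s : ℕ → A) (i j k : ℕ) :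
    window s i k = window s j k ↔ ∀ n < k, s (i + n) = s (j + n) := by
  simp [window]

theorem complexity_eq {A : Type*} (s : ℕ → A) (k : ℕ) :
    complexity s k = (Set.range fun i => window s i k).ncard := by
  unfold complexity
  congr 1
  ext l
  constructor
  · rintro ⟨rfl, i, hi⟩
    exact ⟨i, hi.symm⟩
  · rintro ⟨i, rfl⟩
    exact ⟨window_length' s i k, i, by simp only [window_length']⟩

theorem window_take {A : Type*} (s : ℕ → A) (i k : ℕ) :
    (window s i (k+1)).take k = window s i k := by
  simp [window, List.range_succ]

theorem windows_finite {A : Type*} (s : ℕ → A) (hfin : (Set.range s).Finite) (k : ℕ) :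
    (Set.range fun i => window s i k).Finite := by
  induction k with
  | zero => simp [window]
  | succ k ih =>
    refine (Set.Finite.image2 (fun l x => l ++ [x]) ih hfin).subset ?_
    rintro _ ⟨i, rfl⟩
    exact ⟨window s i k, ⟨i, rfl⟩, s (i + k), ⟨_, rfl⟩, by simp [window, List.range_succ]⟩

theorem windows_image {A : Type*} (s : ℕ → A) (k : ℕ) :
    (List.take k) '' (Set.range fun i => window s i (k+1)) = Set.range fun i => window s i k := by
  rw [← Set.range_comp]
  congr 1
  funext i
  exact window_take s i k

theorem complexity_mono {A : Type*} (s : ℕ → A) (hfin : (Set.range s).Finite) (k : ℕ) :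
    complexity s k ≤ complexity s (k+1) := by
  rw [complexity_eq, complexity_eq, ← windows_image]
  exact Set.ncard_image_le (windows_finite s hfin _)

theorem complexity_one {A : Type*} (s : ℕ → A) :
    complexity s 1 = (Set.range s).ncard := by
  rw [complexity_eq, ← Set.ncard_image_of_injective (Set.range s) (f := fun x => [x])
    (fun x y h => by simpa using h), ← Set.range_comp]
  rfl

theorem up_of_eq {A : Type*} (s : ℕ → A) (hfin : (Set.range s).Finite) (k : ℕ) (hk : 1 ≤ k)
    (h : complexity s (k+1) = complexity s k) : UltimatelyPeriodic s := by
  rw [complexity_eq, complexity_eq, ← windows_image s k] at h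
  have inj := Set.injOn_of_ncard_image_eq h.symm (windows_finite s hfin _)
  have step : ∀ i j, window s i k = window s j k → window s (i+1) k = window s (j+1) k := by
    intro i j hij
    have := inj ⟨i, rfl⟩ ⟨j, rfl⟩ (by simpa only [window_take] using hij)
    simp only [window_eq_iff] at this ⊢
    intro n hn
    have := this (n+1) (by omega)
    rwa [show i + (n+1) = i+1+n by omega, show j + (n+1) = j+1+n by omega] at this
  obtain ⟨i, j, hlt, he⟩ : ∃ i j, i < j ∧ window s i k = window s j k := by
    by_contra! hc
    have hinj : Function.Injective fun i => window s i k := by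
      intro i j hij
      rcases lt_trichotomy i j with h | h | h
      · exact absurd hij (hc _ _ h)
      · exact h
      · exact absurd hij.symm (hc _ _ h)
    exact Set.infinite_range_of_injective hinj (windows_finite s hfin k)
  have all : ∀ n, window s (i+n) k = window s (j+n) k := by
    intro n
    induction n with
    | zero => exact he
    | succ n ih => exact step _ _ ih
  refine ⟨i, j - i, by omega, fun n hn => ?_⟩
  have := (window_eq_iff _ _ _ _).1 (all (n - i)) 0 hk
  rw [show n + (j - i) = j + (n - i) + 0 by omega, ← this]
  congr 1
  omega

theorem bdd_of_up {A : Type*} (s : ℕ → A) (h : UltimatelyPeriodic s) :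
    ∃ M, ∀ k ≥ 1, complexity s k ≤ M := by
  obtain ⟨N, q, hq, h⟩ := h
  refine ⟨N + q, fun k _ => ?_⟩
  have key : ∀ n, ∃ m < N + q, window s n k = window s m k := by
    intro n
    induction n using Nat.strong_induction_on with
    | _ n ih =>
      by_cases hn : n < N + q
      · exact ⟨n, hn, rfl⟩
      · obtain ⟨m, hm, e⟩ := ih (n - q) (by omega)
        refine ⟨m, hm, ?_⟩
        rw [← e, window_eq_iff]
        intro t _
        rw [← h (n - q + t) (by omega)]
        congr 1
        omega
  rw [complexity_eq]
  have hsub : (Set.range fun i => window s i k) ⊆ (fun i => window s i k) '' (Set.Iio (N+q)) := by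
    rintro _ ⟨i, rfl⟩
    obtain ⟨m, hm, e⟩ := key i
    exact ⟨m, hm, e.symm⟩
  have hf := Set.finite_Iio (N+q)
  calc _ ≤ _ := Set.ncard_le_ncard hsub (hf.image _)
    _ ≤ (Set.Iio (N+q)).ncard := Set.ncard_image_le hf
    _ = N + q := by simp [Set.ncard_eq_toFinset_card']

/-- Lemma (Morse–Hedlund): equivalence of six properties for a sequence taking
exactly `a ≥ 2` distinct values, with complexity function `p = complexity s`. -/
theorem stmt0 {A : Type*} (s : ℕ → A) (a : ℕ) (ha : 2 ≤ a)
    (hfin : (Set.range s).Finite) (hcard : (Set.range s).ncard = a) :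
    List.TFAE
      [ ∃ k₀ ≥ 1, complexity s (k₀ + 1) = complexity s k₀,
        ∃ C K, ∀ k ≥ K, complexity s k = C,
        ∃ M, ∀ k ≥ 1, complexity s k ≤ M,
        ∃ k₁ ≥ 1, complexity s k₁ ≤ k₁ + a - 2,
        ∃ k₂ ≥ 1, (complexity s (k₂ + 1) : ℤ) - (k₂ + 1) < (complexity s k₂ : ℤ) - k₂,
        UltimatelyPeriodic s ] := by
  have mono := complexity_mono s hfin
  have mono' : Monotone (complexity s) := monotone_nat_of_le_succ mono
  tfae_have 1 → 6 := fun ⟨k, hk, h⟩ => up_of_eq s hfin k hk h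
  tfae_have 6 → 3 := bdd_of_up s
  tfae_have 3 → 2 := by
    rintro ⟨M, hM⟩
    have hf : (Set.range (complexity s)).Finite := by
      refine (Set.finite_Iic M).subset ?_
      rintro _ ⟨k, rfl⟩
      exact (mono k).trans (hM (k+1) (by omega))
    obtain ⟨_, ⟨K, rfl⟩, hK⟩ := hf.exists_maximal (Set.range_nonempty _)
    exact ⟨complexity s K, K, fun k hk => le_antisymm (hK ⟨k, rfl⟩ (mono' hk)) (mono' hk)⟩
  tfae_have 2 → 1 := by
    rintro ⟨C, K, h⟩
    exact ⟨K + 1, by omega, by rw [h _ (by omega), h _ (by omega)]⟩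
  tfae_have 3 → 4 := by
    rintro ⟨M, hM⟩
    exact ⟨M + 1, by omega, (hM _ (by omega)).trans (by omega)⟩
  tfae_have 4 → 1 := by
    rintro ⟨k, hk, h⟩
    by_contra! hc
    have : ∀ n, a + n ≤ complexity s (n + 1) := by
      intro n
      induction n with
      | zero => rw [complexity_one, hcard]; rfl
      | succ n ih =>
        have h1 := hc (n+1) (by omega)
        have h2 := mono (n+1)
        omega
    have := this (k - 1)
    rw [Nat.sub_add_cancel hk] at this
    omega
  tfae_have 1 → 5 := by
    rintro ⟨k, hk, h⟩
    exact ⟨k, hk, by rw [h]; omega⟩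
  tfae_have 5 → 1 := by
    rintro ⟨k, hk, h⟩
    exact ⟨k, hk, by have := mono k; omega⟩
  tfae_finish
end

section
/- A binary sequence s : ℕ → {0,1} is Sturmian (has complexity p(k) = k + 1 for all k ≥ 1) if and only if s is balanced and aperiodic. -/
namespace SturmAux

def E (s : ℕ → Fin 2) (k i j : ℕ) : Prop := ∀ t < k, s (i + t) = s (j + t)

def RS (s : ℕ → Fin 2) (k i : ℕ) : Prop := ∃ j, E s k i j ∧ s (i + k) ≠ s (j + k)

theorem E.symm {s : ℕ → Fin 2} {k i j : ℕ} (h : E s k i j) : E s k j i :=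
  fun t ht => (h t ht).symm

theorem E.trans {s : ℕ → Fin 2} {k i j l : ℕ} (h : E s k i j) (h' : E s k j l) : E s k i l :=
  fun t ht => (h t ht).trans (h' t ht)

theorem E.succ {s : ℕ → Fin 2} {k i j : ℕ} (h : E s k i j) (h' : s (i + k) = s (j + k)) :
    E s (k + 1) i j := by
  intro t ht
  rcases Nat.lt_succ_iff_lt_or_eq.mp ht with h1 | h1
  · exact h t h1
  · rw [h1, h']

theorem E.of_succ {s : ℕ → Fin 2} {k i j : ℕ} (h : E s (k + 1) i j) : E s k i j :=
  fun t ht => h t (by omega)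

theorem E.shift {s : ℕ → Fin 2} {k i j : ℕ} (h : E s (k + 1) i j) : E s k (i + 1) (j + 1) := by
  intro t ht
  have := h (t + 1) (by omega)
  rw [show i + 1 + t = i + (t + 1) by ring, show j + 1 + t = j + (t + 1) by ring]
  exact this

theorem ne_cases (x y : Fin 2) (h : x ≠ y) : (x = 0 ∧ y = 1) ∨ (x = 1 ∧ y = 0) := by
  revert x y; decide

theorem RS.reps {s : ℕ → Fin 2} {k i : ℕ} (h : RS s k i) :
    ∃ a b, E s k i a ∧ E s k i b ∧ s (a + k) = 0 ∧ s (b + k) = 1 := by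
  obtain ⟨j, hj, hne⟩ := h
  rcases ne_cases _ _ hne with ⟨h1, h2⟩ | ⟨h1, h2⟩
  · exact ⟨i, j, fun _ _ => rfl, hj, h1, h2⟩
  · exact ⟨j, i, hj, fun _ _ => rfl, h2, h1⟩

theorem RS.of_reps {s : ℕ → Fin 2} {k i a b : ℕ} (ha : E s k i a) (hb : E s k i b)
    (h : s (a + k) ≠ s (b + k)) : RS s k i := by
  by_cases h1 : s (i + k) = s (a + k)
  · exact ⟨b, hb, by rw [h1]; exact h⟩
  · exact ⟨a, ha, h1⟩

theorem RS.congr {s : ℕ → Fin 2} {k i j : ℕ} (h : RS s k i) (e : E s k i j) : RS s k j := by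
  obtain ⟨a, b, ha, hb, h0, h1⟩ := h.reps
  exact RS.of_reps (e.symm.trans ha) (e.symm.trans hb) (by rw [h0, h1]; decide)

theorem not_RS_succ {s : ℕ → Fin 2} {k i j : ℕ} (h : ¬ RS s k i) (e : E s k i j) :
    E s (k + 1) i j := by
  apply e.succ
  by_contra h1
  exact h ⟨j, e, h1⟩

theorem window_length (s : ℕ → Fin 2) (i k : ℕ) : (window s i k).length = k := by
  simp [window]

theorem window_succ (s : ℕ → Fin 2) (i k : ℕ) :
    window s i (k + 1) = window s i k ++ [s (i + k)] := by
  simp [window, List.range_succ]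

theorem window_eq_iff (s : ℕ → Fin 2) (k i j : ℕ) :
    window s i k = window s j k ↔ E s k i j := by
  simp [window, E]

theorem take_window (s : ℕ → Fin 2) (i k : ℕ) :
    (window s i (k + 1)).take k = window s i k := by
  rw [window_succ, List.take_append_of_le_length (by rw [window_length]), List.take_of_length_le]
  rw [window_length]

def F (s : ℕ → Fin 2) (k : ℕ) : Set (List (Fin 2)) := Set.range (fun i => window s i k)

theorem complexity_eq (s : ℕ → Fin 2) (k : ℕ) : complexity s k = (F s k).ncard := by
  unfold complexity F
  congr 1
  ext l
  simp only [Set.mem_setOf_eq, Set.mem_range, IsFactor]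
  constructor
  · rintro ⟨rfl, i, h⟩
    exact ⟨i, h.symm⟩
  · rintro ⟨i, rfl⟩
    exact ⟨window_length _ _ _, i, by rw [window_length]⟩

theorem F_finite (s : ℕ → Fin 2) (k : ℕ) : (F s k).Finite := by
  apply (List.finite_length_eq (Fin 2) k).subset
  rintro _ ⟨i, rfl⟩
  exact window_length _ _ _

theorem le_of_noRS (s : ℕ → Fin 2) (k : ℕ) (h : ∀ i, ¬ RS s k i) :
    (F s (k + 1)).ncard ≤ (F s k).ncard := by
  apply Set.ncard_le_ncard_of_injOn (List.take k) _ _ (F_finite s k)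
  · rintro _ ⟨i, rfl⟩
    exact ⟨i, (take_window s i k).symm⟩
  · rintro _ ⟨i, rfl⟩ _ ⟨j, rfl⟩ hij
    simp only [take_window, window_eq_iff] at hij ⊢
    exact not_RS_succ (h i) hij

theorem le_succ_of_uniqueRS (s : ℕ → Fin 2) (k : ℕ)
    (h : ∀ i j, RS s k i → RS s k j → E s k i j) :
    (F s (k + 1)).ncard ≤ (F s k).ncard + 1 := by
  by_cases hn : ∀ i, ¬ RS s k i
  · have := le_of_noRS s k hn
    omega
  push Not at hn
  obtain ⟨i₀, hi₀⟩ := hn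
  obtain ⟨_, r, _, hr, _, hr1⟩ := hi₀.reps
  have hrr := hi₀.congr hr
  have hmem : window s r (k + 1) ∈ F s (k + 1) := ⟨r, rfl⟩
  have h1 := Set.ncard_sdiff_singleton_add_one hmem (F_finite s (k + 1))
  rw [← h1]
  apply Nat.add_le_add_right
  apply Set.ncard_le_ncard_of_injOn (List.take k) _ _ (F_finite s k)
  · rintro _ ⟨⟨i, rfl⟩, _⟩
    exact ⟨i, (take_window s i k).symm⟩
  · rintro _ ⟨⟨i, rfl⟩, hi⟩ _ ⟨⟨j, rfl⟩, hj⟩ hij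
    simp only [take_window, window_eq_iff, Set.mem_singleton_iff] at hi hj hij ⊢
    apply hij.succ
    by_contra hne
    have hri : RS s k i := ⟨j, hij, hne⟩
    have hrj := hri.congr hij
    rcases ne_cases _ _ hne with ⟨h1, h2⟩ | ⟨h1, h2⟩
    · exact hj ((h j r hrj hrr).succ (by rw [h2, hr1]))
    · exact hi ((h i r hri hrr).succ (by rw [h1, hr1]))

theorem succ_le_of_RS (s : ℕ → Fin 2) (k i : ℕ) (h : RS s k i) :
    (F s k).ncard + 1 ≤ (F s (k + 1)).ncard := by
  obtain ⟨a, b, ha, hb, ha0, hb1⟩ := h.reps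
  have hmem : window s b (k + 1) ∈ F s (k + 1) := ⟨b, rfl⟩
  have h1 := Set.ncard_sdiff_singleton_add_one hmem (F_finite s (k + 1))
  rw [← h1]
  apply Nat.add_le_add_right
  have hfin : (F s (k + 1) \ {window s b (k + 1)}).Finite := (F_finite s (k + 1)).sdiff
  refine le_trans (Set.ncard_le_ncard ?_ (hfin.image (List.take k))) (Set.ncard_image_le hfin)
  rintro _ ⟨m, rfl⟩
  by_cases hm : E s (k + 1) m b
  · refine ⟨window s a (k + 1), ⟨⟨a, rfl⟩, ?_⟩, ?_⟩
    · simp only [Set.mem_singleton_iff, window_eq_iff]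
      intro h2
      have := h2 k (by omega)
      rw [ha0, hb1] at this
      exact absurd this (by decide)
    · simp only [take_window, window_eq_iff]
      exact (ha.symm.trans hb).trans hm.of_succ.symm
  · exact ⟨window s m (k + 1), ⟨⟨m, rfl⟩, by simpa [window_eq_iff] using hm⟩, take_window _ _ _⟩

theorem unique_of_le (s : ℕ → Fin 2) (k i j : ℕ) (hi : RS s k i) (hj : RS s k j)
    (hle : (F s (k + 1)).ncard ≤ (F s k).ncard + 1) : E s k i j := by
  by_contra hij
  obtain ⟨a, b, ha, hb, ha0, hb1⟩ := hi.reps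
  obtain ⟨c, d, hc, hd, hc0, hd1⟩ := hj.reps
  have key : ∀ x y, s (x + k) = 0 → s (y + k) = 1 → ¬ E s (k + 1) x y := by
    intro x y hx hy h2
    have := h2 k (by omega)
    rw [hx, hy] at this
    exact absurd this (by decide)
  have hmem : window s b (k + 1) ∈ F s (k + 1) := ⟨b, rfl⟩
  have h1 := Set.ncard_sdiff_singleton_add_one hmem (F_finite s (k + 1))
  have hfin1 : (F s (k + 1) \ {window s b (k + 1)}).Finite := (F_finite s (k + 1)).sdiff
  have hmem2 : window s d (k + 1) ∈ F s (k + 1) \ {window s b (k + 1)} := by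
    refine ⟨⟨d, rfl⟩, ?_⟩
    simp only [Set.mem_singleton_iff, window_eq_iff]
    intro h2
    exact hij ((hb.trans h2.of_succ.symm).trans hd.symm)
  have h2 := Set.ncard_sdiff_singleton_add_one hmem2 hfin1
  have hfin : ((F s (k + 1) \ {window s b (k + 1)}) \ {window s d (k + 1)}).Finite := hfin1.sdiff
  have h3 : (F s k).ncard ≤
      ((F s (k + 1) \ {window s b (k + 1)}) \ {window s d (k + 1)}).ncard := by
    refine le_trans (Set.ncard_le_ncard ?_ (hfin.image (List.take k))) (Set.ncard_image_le hfin)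
    rintro _ ⟨m, rfl⟩
    by_cases hm : E s (k + 1) m b
    · refine ⟨window s a (k + 1), ⟨⟨⟨a, rfl⟩, ?_⟩, ?_⟩, ?_⟩
      · simp only [Set.mem_singleton_iff, window_eq_iff]
        exact key _ _ ha0 hb1
      · simp only [Set.mem_singleton_iff, window_eq_iff]
        exact key _ _ ha0 hd1
      · simp only [take_window, window_eq_iff]
        exact (ha.symm.trans hb).trans hm.of_succ.symm
    by_cases hm' : E s (k + 1) m d
    · refine ⟨window s c (k + 1), ⟨⟨⟨c, rfl⟩, ?_⟩, ?_⟩, ?_⟩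
      · simp only [Set.mem_singleton_iff, window_eq_iff]
        exact key _ _ hc0 hb1
      · simp only [Set.mem_singleton_iff, window_eq_iff]
        exact key _ _ hc0 hd1
      · simp only [take_window, window_eq_iff]
        exact (hc.symm.trans hd).trans hm'.of_succ.symm
    · exact ⟨window s m (k + 1), ⟨⟨⟨m, rfl⟩, by simpa [window_eq_iff] using hm⟩,
        by simpa [window_eq_iff] using hm'⟩, take_window _ _ _⟩
  omega

theorem up_of_collision (s : ℕ → Fin 2) (k i j : ℕ) (hij : i < j) (e : E s k i j)
    (h : ∀ m, i ≤ m → m < j → ¬ RS s k m) : UltimatelyPeriodic s := by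
  have h1 : ∀ t, ∃ m, i ≤ m ∧ m < j ∧ E s k m (i + t) := by
    intro t
    induction t with
    | zero => exact ⟨i, le_refl _, hij, fun _ _ => rfl⟩
    | succ t ih =>
      obtain ⟨m, hm1, hm2, hm3⟩ := ih
      have h2 : E s k (m + 1) (i + (t + 1)) := (not_RS_succ (h m hm1 hm2) hm3).shift
      by_cases hm : m + 1 < j
      · exact ⟨m + 1, by omega, hm, h2⟩
      · have : m + 1 = j := by omega
        rw [this] at h2
        exact ⟨i, le_refl _, hij, e.trans h2⟩
  have h2 : ∀ t, ¬ RS s k (i + t) := by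
    intro t hr
    obtain ⟨m, hm1, hm2, hm3⟩ := h1 t
    exact h m hm1 hm2 (hr.congr hm3.symm)
  have h3 : ∀ t, E s (k + 1) (i + t) (j + t) := by
    intro t
    induction t with
    | zero => exact not_RS_succ (h2 0) e
    | succ t ih => exact not_RS_succ (h2 (t + 1)) ih.shift
  refine ⟨i + k, j - i, by omega, ?_⟩
  intro n hn
  have := h3 (n - i - k) k (by omega)
  rw [show i + (n - i - k) + k = n by omega, show j + (n - i - k) + k = n + (j - i) by omega]
    at this
  exact this.symm

theorem up_of_noRS (s : ℕ → Fin 2) (k : ℕ) (h : ∀ m, ¬ RS s k m) : UltimatelyPeriodic s := by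
  have := F_finite s k
  have hf : Finite (F s k) := this
  obtain ⟨x, y, hne, heq⟩ := Finite.exists_ne_map_eq_of_infinite
    (fun i : ℕ => (⟨window s i k, i, rfl⟩ : F s k))
  have e : E s k x y := by
    rw [← window_eq_iff]
    exact congrArg Subtype.val heq
  rcases lt_or_gt_of_ne hne with h1 | h1
  · exact up_of_collision s k x y h1 e fun m _ _ => h m
  · exact up_of_collision s k y x h1 e.symm fun m _ _ => h m

theorem not_sturmian_of_up (s : ℕ → Fin 2) (h : UltimatelyPeriodic s) : ¬ Sturmian s := by
  obtain ⟨N, q, hq, h⟩ := h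
  intro hS
  have h1 := hS (N + q) (by omega)
  rw [complexity_eq] at h1
  have h2 : ∀ i, ∃ m < N + q, E s (N + q) m i := by
    intro i
    induction i using Nat.strong_induction_on with
    | _ i ih =>
      by_cases hi : i < N + q
      · exact ⟨i, hi, fun _ _ => rfl⟩
      · obtain ⟨m, hm, e⟩ := ih (i - q) (by omega)
        refine ⟨m, hm, e.trans ?_⟩
        intro t _
        rw [← h (i - q + t) (by omega)]
        congr 1
        omega
  have h3 : F s (N + q) ⊆ (fun i => window s i (N + q)) '' (Finset.range (N + q) : Set ℕ) := by
    rintro _ ⟨i, rfl⟩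
    obtain ⟨m, hm, e⟩ := h2 i
    exact ⟨m, by simpa using hm, (window_eq_iff _ _ _ _).2 e⟩
  have h4 := Set.ncard_le_ncard h3 ((Finset.finite_toSet _).image _)
  have h5 := Set.ncard_image_le (f := fun i => window s i (N + q))
    (Finset.finite_toSet (Finset.range (N + q)))
  rw [Set.ncard_coe_finset, Finset.card_range] at h5
  omega

def P (s : ℕ → Fin 2) (n : ℕ) : ℤ := ∑ j ∈ Finset.range n, ((s j : ℕ) : ℤ)

theorem P_succ (s : ℕ → Fin 2) (n : ℕ) : P s (n + 1) = P s n + ((s n : ℕ) : ℤ) :=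
  Finset.sum_range_succ _ _

theorem count_window (s : ℕ → Fin 2) (i k : ℕ) :
    ((window s i k).count 1 : ℤ) = P s (i + k) - P s i := by
  induction k with
  | zero => simp [window]
  | succ k ih =>
    rw [window_succ, List.count_append, Nat.cast_add, ih, ← add_assoc, P_succ]
    have : ∀ x : Fin 2, ((List.count 1 [x] : ℕ) : ℤ) = ((x : ℕ) : ℤ) := by decide
    rw [this]
    ring

theorem balanced_iff (s : ℕ → Fin 2) : BalancedSeq s ↔
    ∀ k i j, P s (i + k) - P s i - (P s (j + k) - P s j) ≤ 1 := by
  constructor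
  · intro h k i j
    have := h (window s i k) (window s j k) ⟨i, by rw [window_length]⟩ ⟨j, by rw [window_length]⟩
      (by rw [window_length, window_length])
    rw [count_window, count_window] at this
    omega
  · rintro h u v ⟨i, hu⟩ ⟨j, hv⟩ hl
    rw [hu, hv, count_window, count_window, ← hl]
    have h1 := h u.length i j
    have h2 := h u.length j i
    omega

theorem E.sum {s : ℕ → Fin 2} {k i j : ℕ} (h : E s k i j) :
    P s (i + k) - P s i = P s (j + k) - P s j := by
  rw [← count_window, ← count_window, (window_eq_iff s k i j).2 h]

theorem uniqueRS_of_balanced (s : ℕ → Fin 2)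
    (hb : ∀ k i j, P s (i + k) - P s i - (P s (j + k) - P s j) ≤ 1) (k i j : ℕ)
    (hi : RS s k i) (hj : RS s k j) : E s k i j := by
  -- suffix agreement, downward induction
  have main : ∀ d, d ≤ k → ∀ t, k - d ≤ t → t < k → s (i + t) = s (j + t) := by
    intro d
    induction d with
    | zero => intro _ t h1 h2; omega
    | succ d ih =>
      intro hd t h1 h2
      have ih := ih (by omega)
      by_cases ht : k - d ≤ t
      · exact ih t ht h2
      have ht : t = k - (d + 1) := by omega
      by_contra hne
      have aux : ∀ i j, RS s k i → RS s k j →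
          (∀ t, k - d ≤ t → t < k → s (i + t) = s (j + t)) →
          s (i + t) = 0 → s (j + t) = 1 → False := by
        intro i j hi hj ih h0 h1
        obtain ⟨a, _, ha, _, ha0, _⟩ := hi.reps
        obtain ⟨_, b, _, hb', _, hb1⟩ := hj.reps
        have ea : E s d (a + t + 1) (b + t + 1) := by
          intro r hr
          have e1 := ha (t + 1 + r) (by omega)
          have e2 := hb' (t + 1 + r) (by omega)
          have e3 := ih (t + 1 + r) (by omega) (by omega)
          rw [show a + t + 1 + r = a + (t + 1 + r) by ring,
            show b + t + 1 + r = b + (t + 1 + r) by ring, ← e1, ← e2, e3]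
        have hs := ea.sum
        have hbal := hb (d + 2) (b + t) (a + t)
        have a1 := P_succ s (a + t)
        have a2 := P_succ s (a + k)
        have b1 := P_succ s (b + t)
        have b2 := P_succ s (b + k)
        rw [← ha t h2, h0] at a1
        rw [← hb' t h2, h1] at b1
        rw [ha0] at a2
        rw [hb1] at b2
        rw [show a + t + 1 + d = a + k by omega, show b + t + 1 + d = b + k by omega] at hs
        rw [show a + t + (d + 2) = a + k + 1 by omega,
          show b + t + (d + 2) = b + k + 1 by omega] at hbal
        simp at a1 a2 b1 b2
        omega
      rcases ne_cases _ _ hne with ⟨h0, h1⟩ | ⟨h0, h1⟩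
      · exact aux i j hi hj ih h0 h1
      · exact aux j i hj hi (fun t a b => (ih t a b).symm) h1 h0
  intro t ht
  exact main k le_rfl t (by omega) ht

theorem sturmian_of (s : ℕ → Fin 2) (hb : BalancedSeq s) (ha : ¬ UltimatelyPeriodic s) :
    Sturmian s := by
  rw [balanced_iff] at hb
  have h : ∀ k, (F s k).ncard = k + 1 := by
    intro k
    induction k with
    | zero =>
      have : F s 0 = {[]} := by
        ext l
        simp [F, window, eq_comm]
      rw [this, Set.ncard_singleton]
    | succ k ih =>
      have h1 := le_succ_of_uniqueRS s k (uniqueRS_of_balanced s hb k)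
      have h2 : ∃ m, RS s k m := by
        by_contra hn
        push Not at hn
        exact ha (up_of_noRS s k hn)
      obtain ⟨m, hm⟩ := h2
      have h3 := succ_le_of_RS s k m hm
      omega
  intro k _
  rw [complexity_eq, h]

/-- An unbalanced sequence contains `1w1` (at `i`) and `0w0` (at `j`) with `w` a palindrome. -/
theorem unbalanced (s : ℕ → Fin 2) (hb : ¬ BalancedSeq s) :
    ∃ N i j, s i = 1 ∧ s (i + N + 1) = 1 ∧ s j = 0 ∧ s (j + N + 1) = 0 ∧
      E s N (i + 1) (j + 1) ∧ ∀ t < N, s (i + 1 + t) = s (i + 1 + (N - 1 - t)) := by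
  classical
  rw [balanced_iff] at hb
  push Not at hb
  have hmin := fun m => Nat.find_min hb (m := m)
  obtain ⟨i, j, hij⟩ := Nat.find_spec hb
  generalize Nat.find hb = n at hmin hij
  have hmin : ∀ m < n, ∀ i j, P s (i + m) - P s i - (P s (j + m) - P s j) ≤ 1 := by
    intro m hm i j
    have := hmin m hm
    push Not at this
    exact this i j
  have hstep : ∀ m, P s (m + 1) = P s m ∧ s m = 0 ∨ P s (m + 1) = P s m + 1 ∧ s m = 1 := by
    intro m
    have h1 := P_succ s m
    have : s m = 0 ∨ s m = 1 := by
      generalize s m = x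
      revert x; decide
    rcases this with h | h <;> rw [h] at h1 <;> simp at h1 <;> simp [h1, h]
  -- lengths
  have hn : 2 ≤ n := by
    by_contra hlt
    have : n = 0 ∨ n = 1 := by omega
    rcases this with rfl | rfl
    · simp at hij
    · have h1 := hstep i
      have h2 := hstep j
      omega
  obtain ⟨N, rfl⟩ : ∃ N, n = N + 2 := ⟨n - 2, by omega⟩
  have hmid : ∀ t ≤ N, P s (i + 1 + t) - P s i - (P s (j + 1 + t) - P s j) = 1 := by
    intro t ht
    have h1 := hmin (1 + t) (by omega) i j
    have h2 := hmin (N + 1 - t) (by omega) (i + 1 + t) (j + 1 + t)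
    rw [show i + 1 + t + (N + 1 - t) = i + (N + 2) by omega,
      show j + 1 + t + (N + 1 - t) = j + (N + 2) by omega] at h2
    rw [← add_assoc, ← add_assoc] at h1
    omega
  have hi0 := hstep i
  have hj0 := hstep j
  have h0 := hmid 0 (by omega)
  have hi1 := hstep (i + N + 1)
  have hj1 := hstep (j + N + 1)
  have hN := hmid N le_rfl
  rw [show i + 1 + N = i + N + 1 by ring, show j + 1 + N = j + N + 1 by ring] at hN
  rw [show i + (N + 2) = i + N + 1 + 1 by ring, show j + (N + 2) = j + N + 1 + 1 by ring] at hij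
  simp only [add_zero] at h0
  have E1 : E s N (i + 1) (j + 1) := by
    intro t ht
    have a := hmid t (by omega)
    have b := hmid (t + 1) (by omega)
    have c := hstep (i + 1 + t)
    have d := hstep (j + 1 + t)
    rw [← add_assoc, ← add_assoc] at b
    rcases c with ⟨c1, c2⟩ | ⟨c1, c2⟩ <;> rcases d with ⟨d1, d2⟩ | ⟨d1, d2⟩ <;>
      first | (rw [c2, d2]; done) | (exfalso; omega)
  refine ⟨N, i, j, ?_, ?_, ?_, ?_, E1, ?_⟩
  · rcases hi0 with ⟨_, h⟩ | ⟨_, h⟩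
    · exfalso; omega
    · exact h
  · rcases hi1 with ⟨_, h⟩ | ⟨_, h⟩
    · exfalso; omega
    · exact h
  · rcases hj0 with ⟨_, h⟩ | ⟨_, h⟩
    · exact h
    · exfalso; omega
  · rcases hj1 with ⟨_, h⟩ | ⟨_, h⟩
    · exact h
    · exfalso; omega
  · have pal : ∀ t ≤ N, P s (i + 1 + t) - P s (i + 1) =
        P s (i + 1 + N) - P s (i + 1 + (N - t)) := by
      intro t ht
      have p1 := hmin (t + 1) (by omega) i (j + 1 + (N - t))
      have p2 := hmin (t + 1) (by omega) (i + 1 + (N - t)) j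
      have m1 := hmid t ht
      have m2 := hmid (N - t) (by omega)
      rw [show i + (t + 1) = i + 1 + t by ring,
        show j + 1 + (N - t) + (t + 1) = j + N + 1 + 1 by omega] at p1
      rw [show j + (t + 1) = j + 1 + t by ring,
        show i + 1 + (N - t) + (t + 1) = i + N + 1 + 1 by omega] at p2
      rw [show i + 1 + N = i + N + 1 by ring]
      omega
    intro t ht
    have q1 := pal t (by omega)
    have q2 := pal (t + 1) (by omega)
    have c := hstep (i + 1 + t)
    have d := hstep (i + 1 + (N - 1 - t))
    rw [show i + 1 + (N - 1 - t) + 1 = i + 1 + (N - t) by omega] at d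
    rw [← add_assoc, show N - (t + 1) = N - 1 - t by omega] at q2
    rcases c with ⟨c1, c2⟩ | ⟨c1, c2⟩ <;> rcases d with ⟨d1, d2⟩ | ⟨d1, d2⟩ <;>
      first | (rw [c2, d2]; done) | (exfalso; omega)

/-- Core step: `x w x` occurs at `i`, and the right special word of length `N+1` (at `r`)
is `y w` with `y ≠ x`. -/
theorem core (s : ℕ → Fin 2) (N i r : ℕ) (hx : s i = s (i + N + 1))
    (hpal : ∀ t < N, s (i + 1 + t) = s (i + 1 + (N - 1 - t)))
    (hr : s r ≠ s i) (hw : E s N (r + 1) (i + 1)) (hRS : RS s (N + 1) r)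
    (huniq : ∀ m, RS s (N + 1) m → E s (N + 1) m r)
    (hcard : (F s (N + 1)).ncard = N + 2) : UltimatelyPeriodic s := by
  have hno : ∀ m ≤ N + 1, ¬ E s (N + 1) (i + m) r := by
    intro m hm e
    have e0 := e 0 (by omega)
    simp only [add_zero] at e0
    by_cases h0 : m = 0
    · subst h0; exact hr e0.symm
    by_cases h1 : m = N + 1
    · subst h1
      rw [← add_assoc, ← hx] at e0
      exact hr e0.symm
    have e1 := e (N + 1 - m) (by omega)
    have e2 := hw (N - m) (by omega)
    have e3 := hpal (m - 1) (by omega)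
    rw [show i + m + (N + 1 - m) = i + N + 1 by omega,
      show r + (N + 1 - m) = r + 1 + (N - m) by omega, e2, ← hx] at e1
    rw [show i + 1 + (m - 1) = i + m by omega, show N - 1 - (m - 1) = N - m by omega, ← e1,
      e0] at e3
    exact hr e3
  have hnoRS : ∀ m ≤ N + 1, ¬ RS s (N + 1) (i + m) := fun m hm h => hno m hm (huniq _ h)
  have hmem : window s r (N + 1) ∈ F s (N + 1) := ⟨r, rfl⟩
  have h1 := Set.ncard_sdiff_singleton_add_one hmem (F_finite s (N + 1))
  have hfin : (F s (N + 1) \ {window s r (N + 1)}).Finite := (F_finite s (N + 1)).sdiff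
  have hcol : ∃ a ∈ (Finset.range (N + 2) : Set ℕ), ∃ b ∈ (Finset.range (N + 2) : Set ℕ),
      a ≠ b ∧ window s (i + a) (N + 1) = window s (i + b) (N + 1) := by
    apply Set.exists_ne_map_eq_of_ncard_lt_of_maps_to
      (t := F s (N + 1) \ {window s r (N + 1)}) _ _ hfin
    · rw [Set.ncard_coe_finset, Finset.card_range]; omega
    · intro a ha
      refine ⟨⟨i + a, rfl⟩, ?_⟩
      simp only [Set.mem_singleton_iff, window_eq_iff]
      simp at ha
      exact hno a (by omega)
  obtain ⟨a, ha, b, hb, hab, e⟩ := hcol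
  simp at ha hb
  rw [window_eq_iff] at e
  have fin : ∀ a b, a < b → b < N + 2 → E s (N + 1) (i + a) (i + b) → UltimatelyPeriodic s := by
    intro a b hab hb e
    apply up_of_collision s (N + 1) (i + a) (i + b) (by omega) e
    intro m hm1 hm2
    have := hnoRS (m - i) (by omega)
    rwa [show i + (m - i) = m by omega] at this
  rcases lt_or_gt_of_ne hab with h | h
  · exact fin a b h hb e
  · exact fin b a h ha e.symm

theorem balanced_of_sturmian (s : ℕ → Fin 2) (hS : Sturmian s) : BalancedSeq s := by
  have hna : ¬ UltimatelyPeriodic s := fun h => not_sturmian_of_up s h hS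
  have hc : ∀ k, (F s (k + 1)).ncard = k + 2 := by
    intro k
    rw [← complexity_eq]
    exact hS (k + 1) (by omega)
  have hc0 : (F s 0).ncard = 1 := by
    have : F s 0 = {[]} := by
      ext l
      simp [F, window, eq_comm]
    rw [this, Set.ncard_singleton]
  have huniq : ∀ k i j, RS s k i → RS s k j → E s k i j := by
    intro k i j hi hj
    apply unique_of_le s k i j hi hj
    cases k with
    | zero => rw [hc, hc0]
    | succ k => rw [hc, hc]
  by_contra hb
  obtain ⟨N, i, j, hi0, hi1, hj0, hj1, hE, hpal⟩ := unbalanced s hb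
  have hr : ∃ r, RS s (N + 1) r := by
    by_contra hn
    push Not at hn
    exact hna (up_of_noRS s _ hn)
  obtain ⟨r, hr⟩ := hr
  have hRSi : RS s N (i + 1) := by
    refine ⟨j + 1, hE, ?_⟩
    rw [show i + 1 + N = i + N + 1 by ring, show j + 1 + N = j + N + 1 by ring, hi1, hj1]
    decide
  have hRSr : RS s N (r + 1) := by
    obtain ⟨a, ha, hne⟩ := hr
    refine ⟨a + 1, ha.shift, ?_⟩
    rw [show r + 1 + N = r + (N + 1) by ring, show a + 1 + N = a + (N + 1) by ring]
    exact hne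
  have hw := huniq N _ _ hRSr hRSi
  apply hna
  by_cases hx : s r = 0
  · exact core s N i r (by rw [hi0, hi1]) hpal (by rw [hx, hi0]; decide) hw hr
      (fun m hm => huniq _ _ _ hm hr) (hc N)
  · refine core s N j r (by rw [hj0, hj1]) ?_ (by rw [hj0]; exact hx) (hw.trans hE) hr
      (fun m hm => huniq _ _ _ hm hr) (hc N)
    intro t ht
    rw [← hE t ht, ← hE (N - 1 - t) (by omega)]
    exact hpal t ht

end SturmAux

/-- A binary sequence is Sturmian iff it is balanced and aperiodic. -/
theorem stmt2 (s : ℕ → Fin 2) :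
    Sturmian s ↔ BalancedSeq s ∧ ¬ UltimatelyPeriodic s := by
  constructor
  · intro h
    exact ⟨SturmAux.balanced_of_sturmian s h, fun h' => SturmAux.not_sturmian_of_up s h' h⟩
  · rintro ⟨h1, h2⟩
    exact SturmAux.sturmian_of s h1 h2
end

section
/- An aperiodic binary sequence u is characteristic Sturmian — i.e., there exists an irrational α ∈ (0,1) with u(n) = ⌊(n+2)α⌋ − ⌊(n+1)α⌋ for all n ≥ 0 — if and only if 0·u < T^k(u) < 1·u for all k ≥ 0, where < is the strict lexicographic order on binary sequences. -/
namespace S7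
open Finset

/-- partial sums -/
def ps (s : ℕ → Fin 2) (m : ℕ) : ℤ := ∑ j ∈ range m, ((s j : ℕ) : ℤ)

lemma ps_zero (s) : ps s 0 = 0 := by simp [ps]
lemma ps_succ (s m) : ps s (m+1) = ps s m + ((s m : ℕ) : ℤ) := by simp [ps, sum_range_succ]

lemma ps_congr {s t : ℕ → Fin 2} {i : ℕ} (h : ∀ j < i, s j = t j) : ps s i = ps t i := by
  unfold ps
  apply sum_congr rfl
  intro j hj
  rw [h j (by simpa using hj)]

lemma ps_add (s : ℕ → Fin 2) (m n : ℕ) : ps s (m+n) = ps s m + ps (fun j => s (m+j)) n := by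
  simp [ps, sum_range_add]

lemma ps_pre (x : Fin 2) (u : ℕ → Fin 2) (n : ℕ) :
    ps (pre x u) (n+1) = ((x : ℕ) : ℤ) + ps u n := by
  unfold ps
  rw [sum_range_succ']
  simp [pre]
  ring

lemma shift_iter (u : ℕ → Fin 2) (k : ℕ) : shiftMap^[k] u = fun j => u (k+j) := by
  induction k generalizing u with
  | zero => simp
  | succ k ih =>
    rw [Function.iterate_succ_apply, ih]
    funext j
    simp only [shiftMap]
    congr 1; omega

lemma lt_of_ps {s t : ℕ → Fin 2} (h : ∀ m, ps s m ≤ ps t m) (hne : s ≠ t) : SeqLt s t := by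
  classical
  have hex : ∃ i, s i ≠ t i := by
    by_contra hc
    push Not at hc
    exact hne (funext hc)
  refine ⟨Nat.find hex, ?_, ?_⟩
  · intro j hj
    simpa using Nat.find_min hex hj
  · have h1 := h (Nat.find hex + 1)
    have h2 : ps s (Nat.find hex) = ps t (Nat.find hex) :=
      ps_congr (fun j hj => by simpa using Nat.find_min hex hj)
    have h3 := Nat.find_spec hex
    rw [ps_succ, ps_succ, h2] at h1
    have h4 : (s (Nat.find hex) : ℕ) ≤ (t (Nat.find hex) : ℕ) := by
      have := (add_le_add_iff_left _).1 h1
      exact_mod_cast this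
    exact lt_of_le_of_ne h4 h3

lemma fwd (u : ℕ → Fin 2) (hap : ¬ UltimatelyPeriodic u) (α : ℝ) (hα : α ∈ Set.Ioo (0 : ℝ) 1)
    (h : IsCharSturmian α u) (k : ℕ) :
    SeqLt (pre 0 u) (shiftMap^[k] u) ∧ SeqLt (shiftMap^[k] u) (pre 1 u) := by
  have hS : ∀ n, ps u n = ⌊((n:ℝ)+1) * α⌋ := by
    intro n
    induction n with
    | zero =>
      rw [ps_zero]; symm
      rw [Int.floor_eq_iff]
      simp
      exact ⟨hα.1.le, hα.2⟩
    | succ n ih =>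
      rw [ps_succ, ih, h n]
      push_cast
      ring_nf
  have hP : ∀ m, ps (fun j => u (k+j)) m = ⌊((k:ℝ)+1)*α + (m:ℝ)*α⌋ - ⌊((k:ℝ)+1) * α⌋ := by
    intro m
    have h1 := ps_add u k m
    rw [hS, hS] at h1
    push_cast at h1
    rw [show ((k:ℝ)+1)*α + (m:ℝ)*α = ((k:ℝ)+m+1)*α by ring]
    linarith
  have hne : ∀ x, pre x u ≠ fun j => u (k+j) := by
    intro x he
    apply hap
    refine ⟨0, k+1, by omega, fun n _ => ?_⟩
    have := congrFun he (n+1)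
    simp only [pre] at this
    rw [this]; congr 1; omega
  have ha : ∀ x m, ps (pre x u) (m+1) = ((x : ℕ) : ℤ) + ⌊(((m+1:ℕ)):ℝ) * α⌋ := by
    intro x m
    rw [ps_pre, hS]; push_cast; rfl
  rw [shift_iter]
  constructor
  · apply lt_of_ps _ (hne 0)
    rintro (_|m)
    · simp [ps_zero]
    · rw [ha, hP]
      have := Int.le_floor_add (((k:ℝ)+1)*α) (((m+1:ℕ):ℝ)*α)
      simp
      push_cast at this
      linarith
  · apply lt_of_ps _ (hne 1).symm
    rintro (_|m)
    · simp [ps_zero]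
    · rw [ha, hP]
      have := Int.le_floor_add_floor (((k:ℝ)+1)*α) (((m+1:ℕ):ℝ)*α)
      simp
      push_cast at this
      linarith

lemma fin2_lt {a b : Fin 2} (h : a < b) : ((a:ℕ):ℤ) = 0 ∧ ((b:ℕ):ℤ) = 1 := by
  revert a b; decide

lemma bal (u : ℕ → Fin 2)
    (H : ∀ k : ℕ, SeqLt (pre 0 u) (shiftMap^[k] u) ∧ SeqLt (shiftMap^[k] u) (pre 1 u)) :
    ∀ m k, ps (pre 0 u) m ≤ ps (fun j => u (k+j)) m ∧
      ps (fun j => u (k+j)) m ≤ ps (pre 0 u) m + 1 := by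
  intro m
  induction m using Nat.strong_induction_on with
  | _ m ih =>
    intro k
    rcases m with _ | m
    · simp [ps_zero]
    obtain ⟨⟨i, hi, hi'⟩, ⟨l, hl, hl'⟩⟩ := H k
    rw [shift_iter] at hi hi' hl hl'
    have key : ∀ x, ∀ i ≤ m, ps (pre x u) (m+1) = ps (pre x u) (i+1) + ps (fun j => u (i+j)) (m-i) ∧
        ps (fun j => u (k+j)) (m+1) = ps (fun j => u (k+j)) (i+1) + ps (fun j => u ((k+i+1)+j)) (m-i) := by
      intro x i him
      obtain ⟨d, rfl⟩ := Nat.exists_eq_add_of_le him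
      constructor
      · rw [ps_pre, ps_pre, ps_add]; simp; ring
      · rw [show i+d+1 = (i+1)+d by ring, ps_add]; simp
        congr 1; funext j; congr 1; ring
    have hx : ps (pre 1 u) (m+1) = ps (pre 0 u) (m+1) + 1 := by
      rw [ps_pre, ps_pre]; simp; ring
    constructor
    · by_cases him : i ≤ m
      · obtain ⟨h1, h2⟩ := key 0 i him
        have h3 := ih (m-i) (by omega) i
        have h4 := ih (m-i) (by omega) (k+i+1)
        have h5 := ps_congr hi
        rw [ps_succ _ i] at h1 h2
        have h6 := fin2_lt hi'
        simp only at h6 h2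
        linarith [h3.1, h3.2, h4.1, h4.2, h6.1, h6.2]
      · exact (ps_congr (fun j hj => hi j (by omega))).le
    · rw [← hx]
      by_cases him : l ≤ m
      · obtain ⟨h1, h2⟩ := key 1 l him
        have h3 := ih (m-l) (by omega) l
        have h4 := ih (m-l) (by omega) (k+l+1)
        have h5 := ps_congr hl
        rw [ps_succ _ l] at h1 h2
        have h6 := fin2_lt hl'
        simp only at h6 h2
        linarith [h3.1, h3.2, h4.1, h4.2, h6.1, h6.2]
      · exact (ps_congr (fun j hj => hl j (by omega))).le

lemma slope (a : ℕ → ℤ) (h0 : a 0 = 0)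
    (h : ∀ n m, 1 ≤ n → a n + a m ≤ a (n+m) ∧ a (n+m) ≤ a n + a m + 1) :
    (∀ (k n : ℕ), 1 ≤ n → (k:ℤ) * a n ≤ a (k*n)) ∧ (∀ (k n : ℕ), 1 ≤ n → a ((k+1)*n) + 1 ≤ ((k:ℤ)+1) * (a n + 1)) ∧
    ∃ α : ℝ, ∀ n : ℕ, 1 ≤ n → (a n : ℝ) ≤ n * α ∧ n * α ≤ a n + 1 := by
  have A : ∀ (k n : ℕ), 1 ≤ n → (k:ℤ) * a n ≤ a (k*n) := by
    intro k n hn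
    induction k with
    | zero => simp [h0]
    | succ k ih =>
      have := (h n (k*n) hn).1
      rw [show n + k*n = (k+1)*n by ring] at this
      push_cast
      linarith
  have B : ∀ (k n : ℕ), 1 ≤ n → a ((k+1)*n) + 1 ≤ ((k:ℤ)+1) * (a n + 1) := by
    intro k n hn
    induction k with
    | zero => simp
    | succ k ih =>
      have := (h n ((k+1)*n) hn).2
      rw [show n + (k+1)*n = (k+1+1)*n by ring] at this
      push_cast
      linarith
  refine ⟨A, B, ?_⟩
  have C : ∀ n m : ℕ, (a (n+1) : ℝ) / ((n:ℝ)+1) ≤ ((a (m+1):ℝ) + 1) / ((m:ℝ)+1) := by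
    intro n m
    rw [div_le_div_iff₀ (by positivity) (by positivity)]
    have h1 := A (m+1) (n+1) (by omega)
    have h2 := B n (m+1) (by omega)
    rw [show (m+1)*(n+1) = (n+1)*(m+1) by ring] at h1
    have h3 : a (n+1) * ((m:ℤ)+1) ≤ (a (m+1) + 1) * ((n:ℤ)+1) := by
      push_cast at h1; linarith
    exact_mod_cast h3
  refine ⟨⨆ n : ℕ, (a (n+1) : ℝ) / ((n:ℝ)+1), ?_⟩
  intro n hn
  obtain ⟨n, rfl⟩ := Nat.exists_eq_add_of_le' hn
  have hb : BddAbove (Set.range fun n : ℕ => (a (n+1) : ℝ) / ((n:ℝ)+1)) :=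
    ⟨_, by rintro _ ⟨x, rfl⟩; exact C x 0⟩
  have h1 := le_ciSup hb n
  have h2 := ciSup_le (fun x => C x n)
  rw [div_le_iff₀ (by positivity)] at h1
  rw [le_div_iff₀ (by positivity)] at h2
  push_cast
  constructor <;> linarith

lemma irr (a : ℕ → ℤ) 
    (h : ∀ n m, 1 ≤ n → a n + a m ≤ a (n+m) ∧ a (n+m) ≤ a n + a m + 1)
    (A : ∀ (k n : ℕ), 1 ≤ n → (k:ℤ) * a n ≤ a (k*n))
    (B : ∀ (k n : ℕ), 1 ≤ n → a ((k+1)*n) + 1 ≤ ((k:ℤ)+1) * (a n + 1))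
    (p : ℤ) (q : ℕ) (hq : 1 ≤ q)
    (h2 : ∀ n : ℕ, 1 ≤ n → q * a n ≤ n * p ∧ n * p ≤ q * (a n + 1)) :
    ∀ n, 1 ≤ n → a (n+q) = a n + p := by
  intro n hn
  have hq' : (1:ℤ) ≤ q := by exact_mod_cast hq
  have hn' : (1:ℤ) ≤ n := by exact_mod_cast hn
  have hh := h n q hn
  have h3 := h2 (n+q) (by omega)
  have h4 := h2 n hn
  have h5 := h2 q hq
  have h6 : a q ≤ p := le_of_mul_le_mul_left h5.1 (by linarith)
  have h7 : p ≤ a q + 1 := le_of_mul_le_mul_left h5.2 (by linarith)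
  push_cast at h3
  have A1 := A n q hq
  have A2 := A q n hn
  obtain ⟨q', rfl⟩ := Nat.exists_eq_add_of_le' hq
  obtain ⟨n', rfl⟩ := Nat.exists_eq_add_of_le' hn
  have B1 := B n' (q'+1) hq
  have B2 := B q' (n'+1) hn
  rw [mul_comm (q'+1) (n'+1)] at A2 B2
  push_cast at *
  rcases (by omega : a (q'+1) = p ∨ a (q'+1) = p - 1) with e | e
  · rw [e] at hh A1 B1
    by_contra hc
    have e2 : a (n'+1+(q'+1)) = a (n'+1) + p + 1 := by omega
    rw [e2] at h3
    nlinarith [h3.1]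
  · rw [e] at hh A1 B1
    by_contra hc
    have e2 : a (n'+1+(q'+1)) = a (n'+1) + p - 1 := by omega
    rw [e2] at h3
    nlinarith [h3.2]

lemma bwd (u : ℕ → Fin 2) (hap : ¬ UltimatelyPeriodic u)
    (H : ∀ k : ℕ, SeqLt (pre 0 u) (shiftMap^[k] u) ∧ SeqLt (shiftMap^[k] u) (pre 1 u)) :
    ∃ α : ℝ, α ∈ Set.Ioo (0 : ℝ) 1 ∧ Irrational α ∧ IsCharSturmian α u := by
  have hb := bal u H
  set a := ps (pre 0 u) with ha
  have h0 : a 0 = 0 := ps_zero _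
  have h1 : a 1 = 0 := by rw [ha, ps_pre, ps_zero]; simp
  have hu : ∀ n, ((u n : ℕ):ℤ) = a (n+2) - a (n+1) := by
    intro n
    rw [ha, ps_succ _ (n+1)]; simp [pre]
  have h : ∀ n m, 1 ≤ n → a n + a m ≤ a (n+m) ∧ a (n+m) ≤ a n + a m + 1 := by
    intro n m hn
    obtain ⟨n, rfl⟩ := Nat.exists_eq_add_of_le' hn
    have e : a (n+1+m) = a (n+1) + ps (fun j => u (n+j)) m := by
      rw [ha, show n+1+m = (n+m)+1 by ring, ps_pre, ps_pre, ps_add]; ring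
    have := hb m n
    constructor <;> linarith [this.1, this.2]
  obtain ⟨A, B, α, hα⟩ := slope a h0 h
  have hirr : Irrational α := by
    rintro ⟨r, rfl⟩
    apply hap
    have hper := irr a h A B r.num r.den r.pos (by
      intro n hn
      have h2 := hα n hn
      have hd : (0:ℝ) < r.den := by exact_mod_cast r.pos
      rw [Rat.cast_def, ← mul_div_assoc, le_div_iff₀ hd, div_le_iff₀ hd] at h2
      constructor
      · have := h2.1
        rw [mul_comm] at this
        exact_mod_cast this
      · have := h2.2
        rw [mul_comm ((a n : ℝ) + 1)] at this
        exact_mod_cast this)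
    refine ⟨0, r.den, r.pos, fun n _ => ?_⟩
    have e1 := hper (n+2) (by omega)
    have e2 := hper (n+1) (by omega)
    have e3 := hu n
    have e4 := hu (n + r.den)
    rw [show n + r.den + 2 = n+2+r.den by ring, show n + r.den + 1 = n+1+r.den by ring] at e4
    apply Fin.ext
    have : ((u (n+r.den) : ℕ):ℤ) = ((u n : ℕ):ℤ) := by linarith
    exact_mod_cast this
  have hfl : ∀ n : ℕ, 1 ≤ n → ⌊(n:ℝ) * α⌋ = a n := by
    intro n hn
    rw [Int.floor_eq_iff]
    have h2 := hα n hn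
    refine ⟨h2.1, lt_of_le_of_ne h2.2 ?_⟩
    intro he
    have h3 : Irrational ((n:ℝ) * α) := hirr.natCast_mul (by omega)
    apply h3.ne_int (a n + 1)
    push_cast; exact he
  refine ⟨α, ⟨?_, ?_⟩, hirr, ?_⟩
  · have := (hα 1 le_rfl).1
    rw [h1] at this
    refine lt_of_le_of_ne (by simpa using this) ?_
    intro h; exact hirr.ne_zero h.symm
  · have := (hα 1 le_rfl).2
    rw [h1] at this
    refine lt_of_le_of_ne (by simpa using this) ?_
    intro h; exact hirr.ne_one h
  · intro n
    rw [hu n, ← hfl (n+2) (by omega), ← hfl (n+1) (by omega)]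
    push_cast; rfl

end S7

/-- An aperiodic binary sequence `u` is characteristic Sturmian iff
`0·u < Tᵏ(u) < 1·u` for all `k ≥ 0`. -/
theorem stmt7 (u : ℕ → Fin 2) (hap : ¬ UltimatelyPeriodic u) :
    (∃ α : ℝ, α ∈ Set.Ioo (0 : ℝ) 1 ∧ Irrational α ∧ IsCharSturmian α u) ↔
    (∀ k : ℕ, SeqLt (pre 0 u) (shiftMap^[k] u) ∧ SeqLt (shiftMap^[k] u) (pre 1 u)) := by
  constructor
  · rintro ⟨α, hα, -, h⟩ k
    exact S7.fwd u hap α hα h k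
  · exact S7.bwd u hap
end
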